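/- arXiv:2211.10626 — 9 statements merged into one kernel-verified Lean document; each statement's English description precedes it below -/
import Mathlib

section
/- Let (X, τ) be a d*-space and let Ω(X) denote X equipped with its specialization order. Then Ω(X) is a consistent dcpo, and every τ-open set is Scott open in Ω(X) (that is, τ ⊆ σ(Ω(X))). -/
open Set
/-- The specialization order on a topological space: `x ≤ y` iff `x ∈ closure {y}`. -/
def specLE {X : Type*} [TopologicalSpace X] (x y : X) : Prop := x ∈ closure {y}

/-- The upper closure `↑x = {y | x ≤ y}` of a point in the specialization order. -/
def upSet {X : Type*} [TopologicalSpace X] (x : X) : Set X := {y | specLE x y}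

/-- A `T₀` space `X` is a *d\*-space* if for every (nonempty) directed subset `D` of `X`
(in the specialization order), every `x ∈ X` and every nonempty open `U`,
`⋂_{d ∈ D} ↑d ∩ ↑x ⊆ U` implies `↑d ∩ ↑x ⊆ U` for some `d ∈ D`. -/
def IsDStarSpace (X : Type*) [TopologicalSpace X] : Prop :=
  ∀ D : Set X, D.Nonempty → DirectedOn specLE D → ∀ x : X, ∀ U : Set X,
    IsOpen U → U.Nonempty →
    (⋂ d ∈ D, upSet d) ∩ upSet x ⊆ U → ∃ d ∈ D, upSet d ∩ upSet x ⊆ U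

/-- `a` is a least upper bound of `D` for the relation `r`. -/
def IsLUBRel {P : Type*} (r : P → P → Prop) (D : Set P) (a : P) : Prop :=
  (∀ d ∈ D, r d a) ∧ ∀ b : P, (∀ d ∈ D, r d b) → r a b

theorem specLE_iff_specializes {X : Type*} [TopologicalSpace X] {x y : X} :
    specLE x y ↔ y ⤳ x :=
  specializes_iff_mem_closure.symm

/-- In a d*-space, a nonempty open set containing all upper bounds of a directed set meets that
directed set. -/
theorem IsDStarSpace.inter_nonempty_of_iInter_upSet_subset {X : Type*} [TopologicalSpace X]
    (h : IsDStarSpace X) {D U : Set X} (hne : D.Nonempty) (hD : DirectedOn specLE D)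
    (hU : IsOpen U) (hUne : U.Nonempty) (hDU : ⋂ d ∈ D, upSet d ⊆ U) : (D ∩ U).Nonempty := by
  obtain ⟨x, hx⟩ := hne
  obtain ⟨d, hd, hdU⟩ := h D ⟨x, hx⟩ hD x U hU hUne (inter_subset_left.trans hDU)
  obtain ⟨e, he, hde, hxe⟩ := hD d hd x hx
  exact ⟨e, he, hdU ⟨hde, hxe⟩⟩

/-- If `(X, τ)` is a d*-space, then `Ω(X)` (i.e. `X` with the specialization order) is a
consistent dcpo (every directed set whose upper bounds set `⋂_{d ∈ D} ↑d` is nonempty has a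
least upper bound), and every `τ`-open set is Scott open with respect to the specialization
order (it is an upper set and meets every directed set having a least upper bound in it). -/
theorem consistent_dcpo_and_open_subset_scott_of_isDStarSpace
    (X : Type*) [TopologicalSpace X] [T0Space X] (h : IsDStarSpace X) :
    (∀ D : Set X, D.Nonempty → DirectedOn specLE D →
      (⋂ d ∈ D, upSet d).Nonempty → ∃ a : X, IsLUBRel specLE D a) ∧
    (∀ U : Set X, IsOpen U →
      (∀ ⦃x y : X⦄, specLE x y → x ∈ U → y ∈ U) ∧
      (∀ D : Set X, D.Nonempty → DirectedOn specLE D → ∀ a : X,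
        IsLUBRel specLE D a → a ∈ U → (D ∩ U).Nonempty)) := by
  refine ⟨fun D hne hD ⟨c, hc⟩ => ?_, fun U hU =>
    ⟨fun x y hxy hx => (specLE_iff_specializes.1 hxy).mem_open hU hx,
      fun D hne hD a ha haU => ?_⟩⟩
  · by_contra! hno
    set B : Set X := ⋂ d ∈ D, upSet d with hB
    have hmem {b : X} : b ∈ B ↔ ∀ d ∈ D, specLE d b := mem_iInter₂
    have hBU : B ⊆ (⋂ b ∈ B, closure {b})ᶜ := fun b hb hbU =>
      hno b ⟨hmem.1 hb, fun e he => mem_iInter₂.1 hbU e (hmem.2 he)⟩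
    obtain ⟨d, hd, hdU⟩ := h.inter_nonempty_of_iInter_upSet_subset hne hD
      (isClosed_biInter fun _ _ => isClosed_closure).isOpen_compl ⟨c, hBU hc⟩ hBU
    exact hdU (mem_iInter₂.2 fun b hb => hmem.1 hb d hd)
  · exact h.inter_nonempty_of_iInter_upSet_subset hne hD hU ⟨a, haU⟩ fun b hb =>
      (specLE_iff_specializes.1 (ha.2 b (mem_iInter₂.1 hb))).mem_open hU haU
end

section
/- For a dcpo P, the Scott space ΣP = (P, σ(P)) is a d*-space if and only if for every Scott-closed set A with A ≠ P and every x ∈ P, the set ↓(↑x ∩ A) is Scott closed. -/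
open Set
/-- The Scott topology on a preorder: opens are the upper sets `U` such that every
directed set having a least upper bound in `U` meets `U`. -/
def scottTopology (P : Type*) [Preorder P] : TopologicalSpace P where
  IsOpen U := IsUpperSet U ∧
    ∀ D : Set P, D.Nonempty → DirectedOn (· ≤ ·) D → ∀ a : P, IsLUB D a → a ∈ U →
      (D ∩ U).Nonempty
  isOpen_univ :=
    ⟨isUpperSet_univ, fun _ hD _ _ _ _ => hD.imp fun _ hd => ⟨hd, trivial⟩⟩
  isOpen_inter U V hU hV := by
    refine ⟨hU.1.inter hV.1, fun D hD hdir a ha haUV => ?_⟩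
    obtain ⟨d₁, hd₁D, hd₁U⟩ := hU.2 D hD hdir a ha haUV.1
    obtain ⟨d₂, hd₂D, hd₂V⟩ := hV.2 D hD hdir a ha haUV.2
    obtain ⟨d₃, hd₃D, h₁₃, h₂₃⟩ := hdir d₁ hd₁D d₂ hd₂D
    exact ⟨d₃, hd₃D, hU.1 h₁₃ hd₁U, hV.1 h₂₃ hd₂V⟩
  isOpen_sUnion S hS := by
    refine ⟨isUpperSet_sUnion fun U hU => (hS U hU).1, fun D hD hdir a ha haS => ?_⟩
    obtain ⟨U, hUS, haU⟩ := haS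
    obtain ⟨d, hdD, hdU⟩ := (hS U hUS).2 D hD hdir a ha haU
    exact ⟨d, hdD, U, hUS, hdU⟩

section
attribute [local instance] scottTopology

theorem isClosed_Iic_scott {P : Type*} [Preorder P] (a : P) : IsClosed (Iic a) := by
  rw [← isOpen_compl_iff]
  refine ⟨(isLowerSet_Iic a).compl, fun D _ _ b hb hba => ?_⟩
  by_contra h
  exact hba (hb.2 fun d hd => by_contra fun hda => h ⟨d, hd, hda⟩)

theorem isLowerSet_of_isClosed_scott {P : Type*} [Preorder P] {A : Set P} (hA : IsClosed A) :
    IsLowerSet A :=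
  isUpperSet_compl.1 hA.isOpen_compl.1

theorem specLE_scott_iff {P : Type*} [Preorder P] {x y : P} : specLE x y ↔ x ≤ y :=
  ⟨fun h => closure_minimal (singleton_subset_iff.2 self_mem_Iic) (isClosed_Iic_scott y) h,
    fun h => isLowerSet_of_isClosed_scott isClosed_closure h (subset_closure rfl)⟩

theorem upSet_scott_eq {P : Type*} [Preorder P] (x : P) : upSet x = Ici x :=
  Set.ext fun _ => specLE_scott_iff

/-- For a dcpo `P`, the Scott space `ΣP` is a d*-space iff for every Scott-closed `A ≠ P`
and every `x ∈ P`, the set `↓(↑x ∩ A)` is Scott closed. -/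
theorem scott_isDStarSpace_iff (P : Type*) [PartialOrder P]
    (hdcpo : ∀ D : Set P, D.Nonempty → DirectedOn (· ≤ ·) D → ∃ a : P, IsLUB D a) :
    IsDStarSpace P ↔
      ∀ A : Set P, IsClosed A → A ≠ Set.univ → ∀ x : P,
        IsClosed {y : P | ∃ b ∈ Set.Ici x ∩ A, y ≤ b} := by
  constructor
  · intro h A hA hne x
    rw [← isOpen_compl_iff]
    refine ⟨fun y z hyz hy ⟨b, hb, hzb⟩ => hy ⟨b, hb, hyz.trans hzb⟩, fun D hD hdir a ha haA => ?_⟩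
    obtain ⟨d, hd, hdU⟩ := h D hD
      (fun c hc d hd => by simpa only [specLE_scott_iff] using hdir c hc d hd) x Aᶜ
      hA.isOpen_compl (nonempty_compl.2 hne) (by
        simp only [upSet_scott_eq]
        intro b hb hbA
        exact haA ⟨b, ⟨hb.2, hbA⟩, ha.2 fun d hd => mem_iInter₂.1 hb.1 d hd⟩)
    simp only [upSet_scott_eq] at hdU
    exact ⟨d, hd, fun ⟨b, hb, hdb⟩ => hdU ⟨hdb, hb.1⟩ hb.2⟩
  · intro h D hD hdir x U hU hne hsub
    have hdir' : DirectedOn (· ≤ ·) D := fun c hc d hd => by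
      simpa only [specLE_scott_iff] using hdir c hc d hd
    obtain ⟨a, ha⟩ := hdcpo D hD hdir'
    simp only [upSet_scott_eq] at hsub ⊢
    have hopen := (h Uᶜ hU.isClosed_compl (fun h => hne.ne_empty (compl_univ_iff.1 h)) x).isOpen_compl
    obtain ⟨d, hd, hdU⟩ := hopen.2 D hD hdir' a ha fun ⟨b, hb, hab⟩ =>
      hb.2 (hsub ⟨mem_iInter₂.2 fun d hd => (ha.1 hd).trans hab, hb.1⟩)
    exact ⟨d, hd, fun b hb => by_contra fun hbU => hdU ⟨b, ⟨hb.2, hbU⟩, hb.1⟩⟩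

end
end

section
/- Let L be a dcpo. If the Scott space (L, σ(L)) is a d*-space, then (L, σ(L)) is weak well-filtered. -/
open Set
section
attribute [local instance] scottTopology

/-- A topological space is *weak well-filtered* if whenever a nonempty open set `U` contains
the intersection of a (nonempty) filtered family of nonempty compact saturated sets, then `U`
contains some member of the family.  A set is saturated if it equals the intersection of all
open sets containing it. -/
def WeakWellFiltered (X : Type*) [TopologicalSpace X] : Prop :=
  ∀ 𝒦 : Set (Set X), 𝒦.Nonempty →
    (∀ K ∈ 𝒦, K.Nonempty ∧ IsCompact K ∧ K = ⋂₀ {U : Set X | IsOpen U ∧ K ⊆ U}) →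
    (∀ K₁ ∈ 𝒦, ∀ K₂ ∈ 𝒦, ∃ K₃ ∈ 𝒦, K₃ ⊆ K₁ ∩ K₂) →
    ∀ U : Set X, IsOpen U → U.Nonempty → ⋂₀ 𝒦 ⊆ U → ∃ K ∈ 𝒦, K ⊆ U

theorem isClosed_scottTopology_iff {L : Type*} [PartialOrder L] {C : Set L} : IsClosed C ↔ IsLowerSet C ∧
    ∀ D : Set L, D.Nonempty → DirectedOn (· ≤ ·) D → ∀ a : L, IsLUB D a → D ⊆ C → a ∈ C := by
  rw [← isOpen_compl_iff]
  change (IsUpperSet Cᶜ ∧ _) ↔ _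
  rw [isUpperSet_compl]
  refine and_congr_right fun _ => forall₅_congr fun D _ _ a _ => ?_
  rw [← not_imp_not, not_nonempty_iff_eq_empty, ← sdiff_eq, sdiff_eq_empty, mem_compl_iff, not_not]

theorem specLE_scottTopology_iff {L : Type*} [PartialOrder L] {x y : L} : specLE x y ↔ x ≤ y := by
  have hclosed : IsClosed (Iic y) :=
    isClosed_scottTopology_iff.2 ⟨isLowerSet_Iic y, fun _ _ _ _ ha hD => ha.2 hD⟩
  refine ⟨fun h => closure_minimal (singleton_subset_iff.2 (mem_Iic.2 le_rfl)) hclosed h, fun h => ?_⟩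
  exact (isClosed_scottTopology_iff.1 isClosed_closure).1 h (subset_closure rfl)

/-- In a d*-space, the lower closure of the trace of a proper closed set on a principal filter
is closed. -/
theorem IsDStarSpace.isClosed_lowerClosure_inter_Ici {L : Type*} [PartialOrder L]
    (h : IsDStarSpace L) {A : Set L}
    (hA : IsClosed A) (hne : Aᶜ.Nonempty) (x : L) :
    IsClosed (lowerClosure (A ∩ Ici x) : Set L) := by
  refine isClosed_scottTopology_iff.2 ⟨LowerSet.lower _, fun D hD hdir a ha hDA => ?_⟩
  by_contra hmem
  have hdir' : DirectedOn specLE D := by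
    simpa only [DirectedOn, specLE_scottTopology_iff] using hdir
  obtain ⟨d, hd, hdU⟩ := h D hD hdir' x Aᶜ hA.isOpen_compl hne fun y hy hyA => by
    have hDy : ∀ d ∈ D, d ≤ y := fun d hd =>
      specLE_scottTopology_iff.1 (mem_iInter₂.1 hy.1 d hd)
    exact hmem ⟨y, ⟨hyA, specLE_scottTopology_iff.1 hy.2⟩, ha.2 hDy⟩
  obtain ⟨z, ⟨hzA, hxz⟩, hdz⟩ := hDA hd
  exact hdU ⟨specLE_scottTopology_iff.2 hdz, specLE_scottTopology_iff.2 hxz⟩ hzA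

/-- In a d*-space, the lower closure of the trace of a proper closed set on a compact upper set
is closed. -/
theorem IsDStarSpace.isClosed_lowerClosure_inter {L : Type*} [PartialOrder L]
    (h : IsDStarSpace L) {A K : Set L}
    (hA : IsClosed A) (hne : Aᶜ.Nonempty) (hK : IsCompact K) (hKu : IsUpperSet K) :
    IsClosed (lowerClosure (A ∩ K) : Set L) := by
  refine isClosed_scottTopology_iff.2 ⟨LowerSet.lower _, fun D hD hdir a ha hDA => ?_⟩
  have : Nonempty D := hD.to_subtype
  have hnonempty :
      (K ∩ ⋂ d : D, (lowerClosure (A ∩ Ici (d : L)) : Set L)).Nonempty := by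
    by_contra hempty
    rw [not_nonempty_iff_eq_empty] at hempty
    obtain ⟨d, hd⟩ := hK.elim_directed_family_closed _
      (fun d : D => h.isClosed_lowerClosure_inter_Ici hA hne d) hempty <| by
        rintro ⟨d, hd⟩ ⟨e, he⟩
        obtain ⟨f, hf, hdf, hef⟩ := hdir d hd e he
        have hmono {b : L} (hb : b ≤ f) : (lowerClosure (A ∩ Ici f) : Set L) ⊆
            lowerClosure (A ∩ Ici b) :=
          lowerClosure_mono (inter_subset_inter_right A (Ici_subset_Ici.2 hb))
        exact ⟨⟨f, hf⟩, hmono hdf, hmono hef⟩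
    obtain ⟨z, ⟨hzA, hzK⟩, hdz⟩ := hDA d.2
    exact eq_empty_iff_forall_notMem.1 hd z ⟨hzK, subset_lowerClosure ⟨hzA, hdz⟩⟩
  obtain ⟨k, hkK, hk⟩ := hnonempty
  have hDk : D ⊆ lowerClosure (A ∩ Ici k) := fun d hd => by
    obtain ⟨z, ⟨hzA, hdz⟩, hkz⟩ := mem_iInter.1 hk ⟨d, hd⟩
    exact ⟨z, ⟨hzA, hkz⟩, hdz⟩
  obtain ⟨z, ⟨hzA, hkz⟩, haz⟩ :=
    (isClosed_scottTopology_iff.1 (h.isClosed_lowerClosure_inter_Ici hA hne k)).2 D hD hdir a ha hDk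
  exact ⟨z, ⟨hzA, hKu hkz hkK⟩, haz⟩

/-- A closed set meeting every member of a family of compact sets contains a minimal such
closed set. -/
theorem exists_minimal_isClosed_inter_nonempty {X : Type*} [TopologicalSpace X]
    {𝒦 : Set (Set X)} (h𝒦 : ∀ K ∈ 𝒦, IsCompact K) {C : Set X} (hC : IsClosed C)
    (hmeet : ∀ K ∈ 𝒦, (K ∩ C).Nonempty) :
    ∃ A ⊆ C, Minimal (fun A => IsClosed A ∧ ∀ K ∈ 𝒦, (K ∩ A).Nonempty) A := by
  refine zorn_superset_nonempty {A | IsClosed A ∧ ∀ K ∈ 𝒦, (K ∩ A).Nonempty} ?_ C ⟨hC, hmeet⟩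
  intro c hc hchain hcne
  refine ⟨⋂₀ c, ⟨isClosed_sInter fun A hA => (hc hA).1, fun K hK => ?_⟩,
    fun A hA => sInter_subset_of_mem hA⟩
  have : Nonempty c := hcne.to_subtype
  by_contra hempty
  rw [not_nonempty_iff_eq_empty, sInter_eq_iInter] at hempty
  obtain ⟨A, hA⟩ := (h𝒦 K hK).elim_directed_family_closed _
    (fun A : c => (hc A.2).1) hempty <| by
      rintro ⟨A, hA⟩ ⟨B, hB⟩
      obtain h | h := hchain.total hA hB
      · exact ⟨⟨A, hA⟩, Subset.rfl, h⟩
      · exact ⟨⟨B, hB⟩, h, Subset.rfl⟩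
  exact ((hc A.2).2 K hK).ne_empty hA

/-- Let `L` be a dcpo.  If the Scott space `(L, σ(L))` is a d*-space, then `(L, σ(L))` is
weak well-filtered. -/
theorem weakWellFiltered_of_isDStarSpace (L : Type*) [PartialOrder L]
    (hdcpo : ∀ D : Set L, D.Nonempty → DirectedOn (· ≤ ·) D → ∃ a : L, IsLUB D a)
    (h : IsDStarSpace L) : WeakWellFiltered L := by
  intro 𝒦 h𝒦ne h𝒦 hfil U hU hUne hsub
  have hupper : ∀ K ∈ 𝒦, IsUpperSet K := fun K hK => by
    rw [(h𝒦 K hK).2.2]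
    exact isUpperSet_sInter fun V hV => hV.1.1
  by_contra! hnot
  obtain ⟨A, hAU, hA⟩ := exists_minimal_isClosed_inter_nonempty
    (fun K hK => (h𝒦 K hK).2.1) hU.isClosed_compl fun K hK => not_subset.1 (hnot K hK)
  obtain ⟨hAclosed, hAmeet⟩ := hA.prop
  have hAlower := (isClosed_scottTopology_iff.1 hAclosed).1
  have hAne : Aᶜ.Nonempty := hUne.mono (subset_compl_comm.1 hAU)
  have hAK : ∀ K ∈ 𝒦, A ⊆ lowerClosure (A ∩ K) := fun K hK => by
    refine hA.le_of_le ⟨h.isClosed_lowerClosure_inter hAclosed hAne (h𝒦 K hK).2.1 (hupper K hK),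
      fun K' hK' => ?_⟩ (lowerClosure_min inter_subset_left hAlower)
    obtain ⟨K₃, hK₃, hK₃sub⟩ := hfil K hK K' hK'
    obtain ⟨z, hzK₃, hzA⟩ := hAmeet K₃ hK₃
    exact ⟨z, (hK₃sub hzK₃).2, subset_lowerClosure ⟨hzA, (hK₃sub hzK₃).1⟩⟩
  obtain ⟨K₀, hK₀⟩ := h𝒦ne
  obtain ⟨x, -, hxA⟩ := hAmeet K₀ hK₀
  obtain ⟨m, -, hm⟩ := zorn_le_nonempty₀ A (fun c hcA hc y hy => by
    obtain ⟨a, ha⟩ := hdcpo c ⟨y, hy⟩ hc.directedOn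
    exact ⟨a, (isClosed_scottTopology_iff.1 hAclosed).2 c ⟨y, hy⟩ hc.directedOn a ha hcA,
      fun z hz => ha.1 hz⟩) x hxA
  refine hAU hm.prop (hsub fun K hK => ?_)
  obtain ⟨z, ⟨hzA, hzK⟩, hmz⟩ := hAK K hK hm.prop
  rwa [hm.eq_of_le hzA hmz]

end
end

section
/- The Johnstone dcpo 𝕁 endowed with the Scott topology is a d*-space. -/
open Set
/-- The Johnstone order on `𝕁 = ℕ × (ℕ ∪ {∞})`:
`(j, k) ≤ (m, n)` iff (`j = m` and `k ≤ n`) or (`n = ∞` and `k ≤ m`). -/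
def jle (p q : ℕ × ℕ∞) : Prop :=
  (p.1 = q.1 ∧ p.2 ≤ q.2) ∨ (q.2 = ⊤ ∧ p.2 ≤ (q.1 : ℕ∞))

/-- The Scott topology attached to a relation `r`: opens are the `r`-upper sets `U` such
that every `r`-directed set having an `r`-least upper bound in `U` meets `U`. -/
def scottTopologyRel {P : Type*} (r : P → P → Prop) : TopologicalSpace P where
  IsOpen U := (∀ ⦃x y : P⦄, x ∈ U → r x y → y ∈ U) ∧
    ∀ D : Set P, D.Nonempty → DirectedOn r D → ∀ a : P, IsLUBRel r D a → a ∈ U →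
      (D ∩ U).Nonempty
  isOpen_univ :=
    ⟨fun _ _ _ _ => trivial, fun _ hD _ _ _ _ => hD.imp fun _ hd => ⟨hd, trivial⟩⟩
  isOpen_inter U V hU hV := by
    refine ⟨fun x y hx hxy => ⟨hU.1 hx.1 hxy, hV.1 hx.2 hxy⟩, fun D hD hdir a ha haUV => ?_⟩
    obtain ⟨d₁, hd₁D, hd₁U⟩ := hU.2 D hD hdir a ha haUV.1
    obtain ⟨d₂, hd₂D, hd₂V⟩ := hV.2 D hD hdir a ha haUV.2
    obtain ⟨d₃, hd₃D, h₁₃, h₂₃⟩ := hdir d₁ hd₁D d₂ hd₂D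
    exact ⟨d₃, hd₃D, hU.1 hd₁U h₁₃, hV.1 hd₂V h₂₃⟩
  isOpen_sUnion S hS := by
    refine ⟨fun x y hx hxy => ?_, fun D hD hdir a ha haS => ?_⟩
    · obtain ⟨U, hUS, hxU⟩ := hx
      exact ⟨U, hUS, (hS U hUS).1 hxU hxy⟩
    · obtain ⟨U, hUS, haU⟩ := haS
      obtain ⟨d, hdD, hdU⟩ := (hS U hUS).2 D hD hdir a ha haU
      exact ⟨d, hdD, U, hUS, hdU⟩

theorem jle_refl (p : ℕ × ℕ∞) : jle p p := Or.inl ⟨rfl, le_rfl⟩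

theorem jle_trans {p q s : ℕ × ℕ∞} (hpq : jle p q) (hqs : jle q s) : jle p s := by
  rcases hpq with ⟨h₁, h₂⟩ | ⟨h₁, h₂⟩ <;> rcases hqs with ⟨h₃, h₄⟩ | ⟨h₃, h₄⟩
  · exact Or.inl ⟨h₁.trans h₃, h₂.trans h₄⟩
  · exact Or.inr ⟨h₃, h₂.trans h₄⟩
  · exact Or.inr ⟨top_le_iff.1 (h₁ ▸ h₄), h₃ ▸ h₂⟩
  · exact absurd (h₁ ▸ h₄) (by simp)

/-- For a preorder relation, the specialization order of its Scott topology is the relation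
itself. -/
theorem specLE_scottTopologyRel {P : Type*} {r : P → P → Prop} (hrefl : ∀ x, r x x)
    (htrans : ∀ {x y z}, r x y → r y z → r x z) (x y : P) :
    @specLE P (scottTopologyRel r) x y ↔ r x y := by
  let := scottTopologyRel r
  unfold specLE
  rw [mem_closure_iff]
  constructor
  · intro h
    by_contra hxy
    have hopen : IsOpen {z | ¬ r z y} := by
      refine ⟨fun a b ha hab hb => ha (htrans hab hb), fun D _ _ a ha haU => ?_⟩
      by_contra hne
      refine haU (ha.2 y fun d hd => ?_)
      by_contra hdy
      exact hne ⟨d, hd, hdy⟩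
    obtain ⟨z, hz, rfl⟩ := h _ hopen hxy
    exact hz (hrefl z)
  · rintro hxy U hU hx
    exact ⟨y, hU.1 hx hxy, rfl⟩

theorem eq_of_jle_of_snd_eq_top {p q : ℕ × ℕ∞} (hp : p.2 = ⊤) (h : jle p q) : p = q := by
  rcases h with ⟨h₁, h₂⟩ | ⟨_, h₂⟩
  · exact Prod.ext h₁ (hp.trans (top_le_iff.1 (hp ▸ h₂)).symm)
  · exact absurd (hp ▸ h₂) (by simp)

theorem isLUBRel_jle_of_unbounded {D : Set (ℕ × ℕ∞)} {j : ℕ} (hcol : ∀ d ∈ D, d.1 = j)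
    (hunb : ∀ n : ℕ, ∃ d ∈ D, (n : ℕ∞) < d.2) : IsLUBRel jle D (j, ⊤) := by
  refine ⟨fun d hd => Or.inl ⟨hcol d hd, le_top⟩, fun b hb => Or.inl ?_⟩
  obtain ⟨d, hd, hlt⟩ := hunb b.1
  have hj : j = b.1 := by
    rcases hb d hd with ⟨h, _⟩ | ⟨_, h⟩
    · exact (hcol d hd).symm.trans h
    · exact absurd h hlt.not_ge
  refine ⟨hj, top_le_iff.2 ?_⟩
  by_contra hne
  obtain ⟨n, hn⟩ := ENat.ne_top_iff_exists.1 hne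
  obtain ⟨e, he, hlt⟩ := hunb n
  rcases hb e he with ⟨_, h⟩ | ⟨h, _⟩
  · exact absurd (hn ▸ h) hlt.not_ge
  · exact hne h

/-- A directed subset of `𝕁` without greatest element is an unbounded subset of a column. -/
theorem exists_column_of_directedOn_jle {D : Set (ℕ × ℕ∞)} (hne : D.Nonempty)
    (hdir : DirectedOn jle D) (hmax : ∀ d ∈ D, ∃ e ∈ D, ¬ jle e d) :
    ∃ j, (∀ d ∈ D, d.1 = j) ∧ ∀ n : ℕ, ∃ d ∈ D, (n : ℕ∞) < d.2 := by
  have hfin : ∀ d ∈ D, d.2 ≠ ⊤ := by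
    intro d hd htop
    obtain ⟨e, he, hed⟩ := hmax d hd
    obtain ⟨f, _, hdf, hef⟩ := hdir d hd e he
    exact hed (eq_of_jle_of_snd_eq_top htop hdf ▸ hef)
  have hle : ∀ d ∈ D, ∀ e ∈ D, jle d e → d.1 = e.1 ∧ d.2 ≤ e.2 :=
    fun d _ e he h => h.resolve_right fun h' => hfin e he h'.1
  have hcol : ∀ d ∈ D, ∀ e ∈ D, d.1 = e.1 := by
    intro d hd e he
    obtain ⟨f, hf, hdf, hef⟩ := hdir d hd e he
    exact (hle d hd f hf hdf).1.trans (hle e he f hf hef).1.symm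
  have hstep : ∀ d ∈ D, ∃ e ∈ D, d.2 < e.2 := by
    intro d hd
    obtain ⟨e, he, hed⟩ := hmax d hd
    exact ⟨e, he, lt_of_not_ge fun h => hed (Or.inl ⟨hcol e he d hd, h⟩)⟩
  obtain ⟨d₀, hd₀⟩ := hne
  refine ⟨d₀.1, fun d hd => hcol d hd d₀ hd₀, fun n => ?_⟩
  induction n with
  | zero =>
    obtain ⟨e, he, hlt⟩ := hstep d₀ hd₀
    exact ⟨e, he, lt_of_le_of_lt (by simp) hlt⟩
  | succ n ih =>
    obtain ⟨d, hd, hnd⟩ := ih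
    obtain ⟨e, he, hlt⟩ := hstep d hd
    refine ⟨e, he, lt_of_le_of_lt ?_ hlt⟩
    exact_mod_cast Order.add_one_le_of_lt hnd

/-- A nonempty Scott open subset of `𝕁` contains all but finitely many maximal points. -/
theorem exists_forall_ge_mem_of_isOpen {U : Set (ℕ × ℕ∞)}
    (hU : @IsOpen _ (scottTopologyRel jle) U) (hne : U.Nonempty) :
    ∃ n : ℕ, ∀ m, n ≤ m → (m, ⊤) ∈ U := by
  obtain ⟨u, hu⟩ := hne
  have htop : (u.1, ⊤) ∈ U := hU.1 hu (Or.inl ⟨rfl, le_top⟩)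
  have hlub : IsLUBRel jle (range fun k : ℕ => (u.1, (k : ℕ∞))) (u.1, ⊤) := by
    refine isLUBRel_jle_of_unbounded (by rintro _ ⟨k, rfl⟩; rfl) fun n => ?_
    exact ⟨_, ⟨n + 1, rfl⟩, Nat.cast_lt.2 n.lt_succ_self⟩
  have hdir : DirectedOn jle (range fun k : ℕ => (u.1, (k : ℕ∞))) := by
    rintro _ ⟨k, rfl⟩ _ ⟨l, rfl⟩
    exact ⟨_, ⟨max k l, rfl⟩, Or.inl ⟨rfl, by simp⟩, Or.inl ⟨rfl, by simp⟩⟩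
  obtain ⟨_, ⟨n, rfl⟩, hn⟩ := hU.2 _ (range_nonempty _) hdir _ hlub htop
  exact ⟨n, fun m hm => hU.1 hn (Or.inr ⟨rfl, Nat.cast_le.2 hm⟩)⟩

/-- The Johnstone dcpo `𝕁` endowed with the Scott topology is a d*-space. -/
theorem johnstone_isDStarSpace :
    @IsDStarSpace (ℕ × ℕ∞) (scottTopologyRel jle) := by
  let := scottTopologyRel jle
  have hspec (x y : ℕ × ℕ∞) : specLE x y ↔ jle x y :=
    specLE_scottTopologyRel jle_refl jle_trans x y
  intro D hD hdir x U hU hUne hsub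
  replace hdir : DirectedOn jle D := fun a ha b hb => by
    simpa only [hspec] using hdir a ha b hb
  have hsub' (y : ℕ × ℕ∞) (hy : ∀ d ∈ D, jle d y) (hxy : jle x y) : y ∈ U :=
    hsub ⟨mem_iInter₂.2 fun d hd => (hspec d y).2 (hy d hd), (hspec x y).2 hxy⟩
  suffices h : ∃ d ∈ D, ∀ y, jle d y → jle x y → y ∈ U by
    obtain ⟨d, hd, h⟩ := h
    exact ⟨d, hd, fun y hy => h y ((hspec d y).1 hy.1) ((hspec x y).1 hy.2)⟩
  by_cases hmax : ∃ d ∈ D, ∀ e ∈ D, jle e d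
  · obtain ⟨d, hd, hgreatest⟩ := hmax
    exact ⟨d, hd, fun y hdy => hsub' y fun e he => jle_trans (hgreatest e he) hdy⟩
  push Not at hmax
  obtain ⟨j, hcol, hunb⟩ := exists_column_of_directedOn_jle hD hdir hmax
  have hlub := isLUBRel_jle_of_unbounded hcol hunb
  by_cases hx : jle x (j, ⊤)
  · obtain ⟨d, hd, hdU⟩ := hU.2 D hD hdir _ hlub (hsub' _ hlub.1 hx)
    exact ⟨d, hd, fun y hdy _ => hU.1 hdU hdy⟩
  · obtain ⟨n, hn⟩ := exists_forall_ge_mem_of_isOpen hU hUne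
    obtain ⟨d, hd, hnd⟩ := hunb n
    refine ⟨d, hd, fun y hdy hxy => ?_⟩
    rcases hdy with ⟨h, _⟩ | ⟨htop, h⟩
    · exact absurd (jle_trans hxy (Or.inl ⟨h.symm.trans (hcol d hd), le_top⟩)) hx
    · have hy : y = (y.1, ⊤) := Prod.ext rfl htop
      rw [hy]
      exact hn _ (by exact_mod_cast hnd.le.trans h)
end

section
/- If A is a saturated subspace of a d*-space X (with the subspace topology), then A is a d*-space. -/
open Set
theorem specLE_coe_iff {X : Type*} [TopologicalSpace X] {A : Set X} {x y : A} :
    specLE (x : X) (y : X) ↔ specLE x y := by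
  rw [specLE_iff_specializes, specLE_iff_specializes, subtype_specializes_iff]

theorem upSet_subset_of_saturated {X : Type*} [TopologicalSpace X] {A : Set X}
    (hA : A = ⋂₀ {U : Set X | IsOpen U ∧ A ⊆ U}) {x : X} (hx : x ∈ A) : upSet x ⊆ A := by
  intro y hxy
  rw [hA]
  rintro U ⟨hU, hAU⟩
  exact (specLE_iff_specializes.1 hxy).mem_open hU (hAU hx)

/-- If `A` is a saturated subspace of a d*-space `X` (saturated means `A` equals the
intersection of all open sets containing it), then `A` with the subspace topology is a
d*-space. -/
theorem isDStarSpace_saturated_subspace (X : Type*) [TopologicalSpace X] [T0Space X]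
    (hX : IsDStarSpace X) (A : Set X)
    (hA : A = ⋂₀ {U : Set X | IsOpen U ∧ A ⊆ U}) :
    IsDStarSpace A := by
  rintro D hD hdir x _ ⟨V, hV, rfl⟩ ⟨a, ha⟩ hsub
  have hdir' : DirectedOn specLE ((↑) '' D : Set X) := by
    rintro _ ⟨d, hd, rfl⟩ _ ⟨e, he, rfl⟩
    obtain ⟨f, hf, hdf, hef⟩ := hdir d hd e he
    exact ⟨f, mem_image_of_mem _ hf, specLE_coe_iff.2 hdf, specLE_coe_iff.2 hef⟩
  have hsub' : (⋂ d ∈ ((↑) '' D : Set X), upSet d) ∩ upSet (x : X) ⊆ V := by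
    rintro y ⟨hyD, hyx⟩
    have hy : (⟨y, upSet_subset_of_saturated hA x.2 hyx⟩ : A) ∈
        (⋂ d ∈ D, upSet d) ∩ upSet x :=
      ⟨mem_iInter₂.2 fun d hd =>
        specLE_coe_iff.1 (mem_iInter₂.1 hyD d (mem_image_of_mem _ hd)), specLE_coe_iff.1 hyx⟩
    exact hsub hy
  obtain ⟨_, ⟨d, hd, rfl⟩, hdV⟩ := hX _ (hD.image _) hdir' x V hV ⟨a, ha⟩ hsub'
  exact ⟨d, hd, fun y hy => hdV ⟨specLE_coe_iff.2 hy.1, specLE_coe_iff.2 hy.2⟩⟩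
end

section
/- A retract of a d*-space is a d*-space: if X is a d*-space and there exist continuous maps s : Y → X and r : X → Y with r ∘ s = id_Y, then Y is a d*-space. -/
open Set
/-- Continuous maps are monotone in the specialization order. -/
theorem specLE.map {X Y : Type*} [TopologicalSpace X] [TopologicalSpace Y] {f : X → Y}
    (hf : Continuous f) {x y : X} (h : specLE x y) : specLE (f x) (f y) := by
  simpa only [specLE, image_singleton] using
    image_closure_subset_closure_image hf (mem_image_of_mem f h)

/-- A retract of a d*-space is a d*-space: if `X` is a d*-space and there are continuous
maps `s : Y → X` and `r : X → Y` with `r ∘ s = id`, then `Y` is a d*-space. -/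
theorem isDStarSpace_retract (X Y : Type*) [TopologicalSpace X] [TopologicalSpace Y]
    [T0Space X] [T0Space Y] (hX : IsDStarSpace X)
    (s : Y → X) (r : X → Y) (hs : Continuous s) (hr : Continuous r)
    (hrs : r ∘ s = id) : IsDStarSpace Y := by
  have hrs' : ∀ y, r (s y) = y := congrFun hrs
  intro D hne hD x U hU hUne hsub
  have hdir : DirectedOn specLE (s '' D) := by
    rintro _ ⟨a, ha, rfl⟩ _ ⟨b, hb, rfl⟩
    obtain ⟨c, hc, hac, hbc⟩ := hD a ha b hb
    exact ⟨s c, mem_image_of_mem s hc, hac.map hs, hbc.map hs⟩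
  have hr_ge : ∀ {y z}, specLE (s y) z → specLE y (r z) := fun {y z} h => by
    simpa only [hrs'] using h.map hr
  have hne_pre : (r ⁻¹' U).Nonempty := by
    obtain ⟨u, hu⟩ := hUne
    exact ⟨s u, by rwa [mem_preimage, hrs']⟩
  obtain ⟨_, ⟨d, hd, rfl⟩, hdU⟩ := hX (s '' D) (hne.image s) hdir (s x) (r ⁻¹' U)
    (hU.preimage hr) hne_pre fun z hz => hsub ⟨mem_iInter₂.2 fun d hd =>
      hr_ge (mem_iInter₂.1 hz.1 (s d) (mem_image_of_mem s hd)), hr_ge hz.2⟩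
  refine ⟨d, hd, fun y hy => ?_⟩
  have h : s y ∈ r ⁻¹' U := hdU ⟨specLE.map hs hy.1, specLE.map hs hy.2⟩
  rwa [mem_preimage, hrs'] at h
end

section
/- The function space [Σ2, Σℕ] of continuous maps from the Sierpiński space Σ2 to the Scott space Σℕ, endowed with the Isbell topology, is not a d*-space, although Σℕ is a d*-space. -/
open Set
/-- A Scott-open subset of a preorder (here used for the complete lattice `O(X)` of open
sets): an upper set inaccessible by least upper bounds of directed sets. -/
def ScottOpenSet {P : Type*} [Preorder P] (H : Set P) : Prop :=
  IsUpperSet H ∧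
    ∀ D : Set P, D.Nonempty → DirectedOn (· ≤ ·) D → ∀ a : P, IsLUB D a → a ∈ H →
      (D ∩ H).Nonempty

open TopologicalSpace in
/-- The Isbell topology on `TOP(X, Y)`, generated by the sets
`N(H ← V) = {f | f⁻¹(V) ∈ H}` with `H` Scott open in the complete lattice `O(X)` of open
subsets of `X` and `V` open in `Y`. -/
def isbellTopology (X Y : Type*) [TopologicalSpace X] [TopologicalSpace Y] :
    TopologicalSpace C(X, Y) :=
  .generateFrom {S | ∃ H : Set (Opens X), ScottOpenSet H ∧
    ∃ V : Opens Y, S = {f : C(X, Y) | Opens.comap f V ∈ H}}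

/-- `Σ2`: the two-element chain `{0, 1}` with `0 < 1` (formalized as `Bool` with
`false < true`), carrying the Scott topology — the Sierpiński space. -/
def Sierp : Type := Bool

instance : LinearOrder Sierp := inferInstanceAs (LinearOrder Bool)

instance : TopologicalSpace Sierp := scottTopology Sierp

/-- `Σℕ`: the natural numbers with their usual order, carrying the Scott topology. -/
def ScottNat : Type := ℕ

instance : LinearOrder ScottNat := inferInstanceAs (LinearOrder ℕ)

instance : TopologicalSpace ScottNat := scottTopology ScottNat

theorem IsLUB.mem_of_finite_Iic {P : Type*} [LinearOrder P] {D : Set P} {a : P}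
    (ha : IsLUB D a) (hD : D.Nonempty) (hfin : (Iic a).Finite) : a ∈ D := by
  obtain ⟨m, hm, hmax⟩ := (hfin.subset fun d hd => ha.1 hd).exists_maximal hD
  have hub : a ≤ m := ha.2 fun d hd => (le_total d m).elim id fun h => hmax hd h
  exact le_antisymm hub (ha.1 hm) ▸ hm

theorem IsUpperSet.isOpen_scottTopology {P : Type*} [LinearOrder P]
    (hfin : ∀ a : P, (Iic a).Finite) {U : Set P} (hU : IsUpperSet U) :
    @IsOpen _ (scottTopology P) U :=
  ⟨hU, fun _ hD _ a ha haU => ⟨a, ha.mem_of_finite_Iic hD (hfin a), haU⟩⟩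

theorem Sierp.finite_Iic (a : Sierp) : (Iic a).Finite :=
  Set.toFinite (α := Bool) _

theorem ScottNat.finite_Iic (a : ScottNat) : (Iic a).Finite :=
  Set.finite_Iic (α := ℕ) a

theorem Sierp.isOpen_of_isUpperSet {U : Set Sierp} (hU : IsUpperSet U) : IsOpen U :=
  hU.isOpen_scottTopology Sierp.finite_Iic

theorem ScottNat.isOpen_of_isUpperSet {U : Set ScottNat} (hU : IsUpperSet U) : IsOpen U :=
  hU.isOpen_scottTopology ScottNat.finite_Iic

theorem ScottNat.isUpperSet_of_isOpen {U : Set ScottNat} (hU : IsOpen U) : IsUpperSet U :=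
  hU.1

theorem ScottNat.specLE_iff {x y : ScottNat} : specLE x y ↔ x ≤ y := by
  refine mem_closure_iff.trans ⟨fun h => ?_, fun h U hU hx =>
    ⟨y, isUpperSet_of_isOpen hU h hx, rfl⟩⟩
  obtain ⟨z, hz, rfl⟩ := h (Ici x) (isOpen_of_isUpperSet (isUpperSet_Ici x)) (mem_Ici.2 le_rfl)
  exact hz

theorem ScottNat.isDStarSpace : IsDStarSpace ScottNat := by
  rintro D hD - x U hU ⟨u, hu⟩ hDU
  by_cases h : ∃ d ∈ D, u ≤ d
  · obtain ⟨d, hd, hud⟩ := h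
    exact ⟨d, hd, fun y hy =>
      isUpperSet_of_isOpen hU (hud.trans (specLE_iff.1 hy.1)) hu⟩
  · push Not at h
    obtain ⟨m, hm, hmax⟩ :=
      ((finite_Iic u).subset fun d hd => (h d hd).le).exists_maximal hD
    refine ⟨m, hm, fun y hy => hDU ⟨mem_iInter₂.2 fun d hd => ?_, hy.2⟩⟩
    exact specLE_iff.2
      (((le_total d m).elim id fun h => hmax hd h).trans (specLE_iff.1 hy.1))

open TopologicalSpace in
theorem scottOpenSet_setOf_mem {X : Type*} [TopologicalSpace X] (p : X) :
    ScottOpenSet {W : Opens X | p ∈ W} := by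
  refine ⟨fun V W hVW hV => hVW hV, fun D _ _ a ha hpa => ?_⟩
  rw [ha.unique (isLUB_sSup D), mem_ofPred_eq, Opens.mem_sSup] at hpa
  exact hpa

theorem isOpen_isbellTopology_setOf_apply_mem {X Y : Type*} [TopologicalSpace X]
    [TopologicalSpace Y] (p : X) {V : Set Y} (hV : IsOpen V) :
    @IsOpen _ (isbellTopology X Y) {f : C(X, Y) | f p ∈ V} :=
  .basic _ ⟨_, scottOpenSet_setOf_mem p, ⟨V, hV⟩, rfl⟩

theorem specLE_isbellTopology_of_forall_le {X : Type*} [TopologicalSpace X]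
    {f g : C(X, ScottNat)} (h : ∀ p, f p ≤ g p) :
    @specLE _ (isbellTopology X ScottNat) f g := by
  let _ := isbellTopology X ScottNat
  refine mem_closure_iff.2 fun U hU hf => ⟨g, ?_, rfl⟩
  induction hU with
  | basic S hS =>
    obtain ⟨H, hH, V, rfl⟩ := hS
    exact hH.1 (fun p hp => ScottNat.isUpperSet_of_isOpen V.isOpen (h p) hp) hf
  | univ => trivial
  | inter S T _ _ ihS ihT => exact ⟨ihS hf.1, ihT hf.2⟩
  | sUnion 𝒮 _ ih =>
    obtain ⟨S, hS, hfS⟩ := hf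
    exact ⟨S, hS, ih S hS hfS⟩

theorem apply_le_of_specLE_isbellTopology {X : Type*} [TopologicalSpace X]
    {f g : C(X, ScottNat)} (h : @specLE _ (isbellTopology X ScottNat) f g) (p : X) :
    f p ≤ g p := by
  let _ := isbellTopology X ScottNat
  obtain ⟨k, hk, rfl⟩ := mem_closure_iff.1 h {k | k p ∈ Ici (f p)}
    (isOpen_isbellTopology_setOf_apply_mem p
      (ScottNat.isOpen_of_isUpperSet (isUpperSet_Ici (f p)))) (le_refl (f p))
  exact hk

/-- The continuous map `Σ2 → Σℕ` sending `0` to `0` and `1` to `n`. -/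
def Sierp.step (n : ℕ) : C(Sierp, ScottNat) where
  toFun b := Bool.rec (0 : ℕ) n b
  continuous_toFun := by
    refine ⟨fun V hV => Sierp.isOpen_of_isUpperSet
      ((ScottNat.isUpperSet_of_isOpen hV).preimage ?_)⟩
    rintro (_ | _) (_ | _) h
    · exact le_rfl
    · exact Nat.zero_le n
    · exact absurd (show (true : Bool) ≤ false from h) (by decide)
    · exact le_rfl

theorem Sierp.specLE_step {m n : ℕ} (h : m ≤ n) :
    @specLE _ (isbellTopology Sierp ScottNat) (step m) (step n) := by
  refine specLE_isbellTopology_of_forall_le ?_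
  rintro (_ | _)
  · exact le_rfl
  · exact h

theorem Sierp.not_isDStarSpace_isbellTopology :
    ¬ @IsDStarSpace C(Sierp, ScottNat) (isbellTopology Sierp ScottNat) := by
  let _ := isbellTopology Sierp ScottNat
  intro h
  have hdir : DirectedOn specLE (range step) := by
    rintro _ ⟨m, rfl⟩ _ ⟨n, rfl⟩
    exact ⟨_, ⟨max m n, rfl⟩, specLE_step (le_max_left m n), specLE_step (le_max_right m n)⟩
  have hempty : ⋂ d ∈ range step, upSet d = ∅ := by
    refine eq_empty_of_forall_notMem fun g hg => ?_
    have hle := apply_le_of_specLE_isbellTopology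
      (mem_iInter₂.1 hg _ ⟨Nat.succ (g (true : Bool)), rfl⟩) (true : Bool)
    exact absurd hle (Nat.not_succ_le_self _)
  obtain ⟨_, ⟨n, rfl⟩, hn⟩ := h (range step) (range_nonempty step) hdir (step 0)
    {f : C(Sierp, ScottNat) | f (false : Bool) ∈ Ici (1 : ℕ)}
    (isOpen_isbellTopology_setOf_apply_mem _
      (ScottNat.isOpen_of_isUpperSet (isUpperSet_Ici (α := ℕ) 1)))
    ⟨ContinuousMap.const Sierp (1 : ℕ), le_refl (1 : ℕ)⟩
    (by rw [hempty, empty_inter]; exact empty_subset _)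
  exact Nat.not_succ_le_zero 0 (hn ⟨specLE_step le_rfl, specLE_step n.zero_le⟩)

/-- The function space `[Σ2, Σℕ]` of continuous maps from the Sierpiński space to the
Scott space of `ℕ`, with the Isbell topology, is not a d*-space, although `Σℕ` is a
d*-space. -/
theorem isbell_sierp_scottNat_not_dstar :
    ¬ @IsDStarSpace C(Sierp, ScottNat) (isbellTopology Sierp ScottNat) ∧
    IsDStarSpace ScottNat := by
  exact ⟨Sierp.not_isDStarSpace_isbellTopology, ScottNat.isDStarSpace⟩
end

section
/- Let X be a T₀ topological space. If the Smyth power space Q_v(X) is a d*-space, then X is a d*-space. -/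
open Set
/-- The Smyth power set `Q(X)`: nonempty compact saturated subsets of `X` (saturated means
an upper set in the specialization order). -/
abbrev SmythPow (X : Type*) [TopologicalSpace X] : Type _ :=
  {K : Set X // K.Nonempty ∧ IsCompact K ∧ ∀ ⦃x y : X⦄, specLE x y → x ∈ K → y ∈ K}

/-- The upper Vietoris topology on `Q(X)`, generated by the sets
`□U = {K ∈ Q(X) | K ⊆ U}` for `U` open in `X`; `Q(X)` with this topology is the Smyth
power space `Q_v(X)`. -/
def upperVietoris (X : Type*) [TopologicalSpace X] : TopologicalSpace (SmythPow X) :=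
  .generateFrom {S | ∃ U : Set X, IsOpen U ∧ S = {K : SmythPow X | K.1 ⊆ U}}

theorem specLE_iff_forall_isOpen {X : Type*} [TopologicalSpace X] {x y : X} :
    specLE x y ↔ ∀ U : Set X, IsOpen U → x ∈ U → y ∈ U := by
  simp [specLE, mem_closure_iff]

theorem specLE_refl {X : Type*} [TopologicalSpace X] (x : X) : specLE x x :=
  subset_closure rfl

theorem specLE_trans {X : Type*} [TopologicalSpace X] {x y z : X}
    (hxy : specLE x y) (hyz : specLE y z) : specLE x z := by
  rw [specLE_iff_forall_isOpen] at *
  exact fun U hU hx => hyz U hU (hxy U hU hx)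

theorem upSet_subset_of_mem {X : Type*} [TopologicalSpace X] {x : X} {U : Set X}
    (hU : IsOpen U) (hx : x ∈ U) : upSet x ⊆ U :=
  fun _ hy => specLE_iff_forall_isOpen.1 hy U hU hx

theorem isCompact_upSet {X : Type*} [TopologicalSpace X] (x : X) : IsCompact (upSet x) := by
  rw [isCompact_iff_finite_subcover]
  intro ι U hU hcover
  obtain ⟨i, hi⟩ := mem_iUnion.1 (hcover (specLE_refl x))
  exact ⟨{i}, by simpa using upSet_subset_of_mem (hU i) hi⟩

/-- The principal upper set of a point, as an element of the Smyth power set. -/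
def principalSmyth {X : Type*} [TopologicalSpace X] (x : X) : SmythPow X :=
  ⟨upSet x, ⟨x, specLE_refl x⟩, isCompact_upSet x, fun _ _ hab ha => specLE_trans ha hab⟩

theorem upperVietoris_specLE_iff {X : Type*} [TopologicalSpace X] {K L : SmythPow X} :
    @specLE _ (upperVietoris X) K L ↔ L.1 ⊆ K.1 := by
  let _ := upperVietoris X
  rw [specLE_iff_forall_isOpen]
  refine ⟨fun h y hy => ?_, fun h S hS => ?_⟩
  · by_contra hyK
    have hK : K.1 ⊆ (closure {y})ᶜ := fun k hk hky => hyK (K.2.2.2 hky hk)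
    have hL : L.1 ⊆ (closure {y})ᶜ :=
      h {M | M.1 ⊆ (closure {y})ᶜ} (.basic _ ⟨_, isClosed_closure.isOpen_compl, rfl⟩) hK
    exact hL hy (specLE_refl y)
  · induction hS with
    | basic S hS =>
      obtain ⟨U, -, rfl⟩ := hS
      exact fun hK => h.trans hK
    | univ => exact fun _ => trivial
    | inter S T _ _ ihS ihT => exact fun hK => ⟨ihS hK.1, ihT hK.2⟩
    | sUnion 𝒮 _ ih =>
      rintro ⟨S, hS, hK⟩
      exact ⟨S, hS, ih S hS hK⟩

/-- If the Smyth power space `Q_v(X)` of a `T₀` space `X` is a d*-space, then `X` is a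
d*-space. -/
theorem isDStarSpace_of_smyth_isDStarSpace (X : Type*) [TopologicalSpace X] [T0Space X]
    (h : @IsDStarSpace (SmythPow X) (upperVietoris X)) : IsDStarSpace X := by
  let _ := upperVietoris X
  intro D hne hdir x U hU ⟨u, hu⟩ hsub
  have hdir' : DirectedOn specLE (principalSmyth '' D) := by
    rintro _ ⟨a, ha, rfl⟩ _ ⟨b, hb, rfl⟩
    obtain ⟨c, hc, hac, hbc⟩ := hdir a ha b hb
    exact ⟨_, ⟨c, hc, rfl⟩, upperVietoris_specLE_iff.2 fun _ hy => specLE_trans hac hy,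
      upperVietoris_specLE_iff.2 fun _ hy => specLE_trans hbc hy⟩
  obtain ⟨_, ⟨d, hd, rfl⟩, hdU⟩ := h (principalSmyth '' D) (hne.image _) hdir'
    (principalSmyth x) {K | K.1 ⊆ U} (.basic _ ⟨U, hU, rfl⟩)
    ⟨principalSmyth u, upSet_subset_of_mem hU hu⟩ (by
      rintro K ⟨hKD, hKx⟩ y hy
      refine hsub ⟨mem_iInter₂.2 fun d hd => ?_, upperVietoris_specLE_iff.1 hKx hy⟩
      exact upperVietoris_specLE_iff.1 (mem_iInter₂.1 hKD _ (mem_image_of_mem _ hd)) hy)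
  refine ⟨d, hd, fun y ⟨hdy, hxy⟩ => ?_⟩
  have hyU : (principalSmyth y).1 ⊆ U :=
    hdU ⟨upperVietoris_specLE_iff.2 fun _ hz => specLE_trans hdy hz,
      upperVietoris_specLE_iff.2 fun _ hz => specLE_trans hxy hz⟩
  exact hyU (specLE_refl y)
end

section
/- Let X = ℕ ∪ {a} (with a ∉ ℕ) carry the topology generated by the cofinite topology on ℕ together with the discrete topology on {a} (i.e., the join refinement, in which every singleton is closed). Then X is a T₁ space, hence a d*-space, but its Smyth power space Q_v(X) is not a d*-space. -/
open Set
/-- The space `X = ℕ ∪ {a}` (formalized as `Option ℕ`, with `none` playing the role of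
`a ∉ ℕ`), topologized by the join of the cofinite topology on `ℕ` and the discrete
topology on `{a}`. -/
def cofiniteJoinTop : TopologicalSpace (Option ℕ) :=
  .generateFrom
    ({S | ∃ U : Set ℕ, (U = ∅ ∨ Uᶜ.Finite) ∧ S = some '' U} ∪ {({none} : Set (Option ℕ))})

theorem specLE_iff_eq {X : Type*} [TopologicalSpace X] [T1Space X] {x y : X} :
    specLE x y ↔ x = y := by
  simp [specLE]

theorem isDStarSpace_of_t1Space (X : Type*) [TopologicalSpace X] [T1Space X] :
    IsDStarSpace X := by
  rintro D ⟨d, hd⟩ hD x U - - h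
  refine ⟨d, hd, fun y hy => h ⟨mem_iInter₂.2 fun e he => ?_, hy.2⟩⟩
  obtain ⟨c, -, hdc, hec⟩ := hD d hd e he
  rw [specLE_iff_eq] at hdc hec
  rw [hec, ← hdc]
  exact hy.1

/-- The specialization order of the Smyth power space of a `T₁` space is reverse inclusion. -/
theorem specLE_upperVietoris_iff {X : Type*} [TopologicalSpace X] [T1Space X]
    {K L : SmythPow X} : @specLE _ (upperVietoris X) K L ↔ L.1 ⊆ K.1 := by
  let := upperVietoris X
  constructor
  · intro h y hy
    by_contra hyK
    have hopen : IsOpen {M : SmythPow X | M.1 ⊆ {y}ᶜ} :=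
      TopologicalSpace.isOpen_generateFrom_of_mem ⟨{y}ᶜ, isOpen_compl_singleton, rfl⟩
    have hL : L.1 ⊆ {y}ᶜ :=
      (specializes_iff_mem_closure.2 h).mem_open hopen (subset_compl_singleton_iff.2 hyK)
    exact hL hy rfl
  · intro h
    refine specializes_iff_mem_closure.1 ?_
    refine (TopologicalSpace.tendsto_nhds_generateFrom_iff (m := id)).2 ?_
    rintro _ ⟨U, hU, rfl⟩ hK
    have hopen : IsOpen {M : SmythPow X | M.1 ⊆ U} :=
      TopologicalSpace.isOpen_generateFrom_of_mem ⟨U, hU, rfl⟩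
    exact hopen.mem_nhds (h.trans hK)

theorem t1Space_cofiniteJoinTop : @T1Space (Option ℕ) cofiniteJoinTop := by
  let := cofiniteJoinTop
  have hnone : IsOpen ({none} : Set (Option ℕ)) :=
    TopologicalSpace.isOpen_generateFrom_of_mem (Or.inr rfl)
  have hsome (U : Set ℕ) (hU : Uᶜ.Finite) : IsOpen (some '' U) :=
    TopologicalSpace.isOpen_generateFrom_of_mem (Or.inl ⟨U, Or.inr hU, rfl⟩)
  refine ⟨fun x => ⟨?_⟩⟩
  cases x with
  | none =>
    convert hsome univ (by simp) using 1
    ext (_ | m) <;> simp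
  | some n =>
    convert hnone.union (hsome {n}ᶜ (by simp)) using 1
    ext (_ | m) <;> simp

theorem continuous_some_cofiniteJoinTop :
    @Continuous (CofiniteTopology ℕ) (Option ℕ) _ cofiniteJoinTop
      (fun n => some (CofiniteTopology.of.symm n)) := by
  refine continuous_generateFrom_iff.2 ?_
  rintro _ (⟨U, hU, rfl⟩ | rfl)
  · rw [CofiniteTopology.isOpen_iff']
    obtain rfl | hU := hU
    · simp
    · right
      rw [← preimage_compl]
      refine (hU.image some).union (finite_singleton none) |>.subset ?_ |>.preimage
        ((Option.some_injective ℕ).comp CofiniteTopology.of.symm.injective).injOn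
      rintro (_ | n) hn
      · simp
      · simpa using hn
  · convert isOpen_empty
    ext n
    simp

theorem isCompact_image_some_cofiniteJoinTop (S : Set ℕ) :
    @IsCompact (Option ℕ) cofiniteJoinTop (some '' S) := by
  let := cofiniteJoinTop
  have h := (TopologicalSpace.NoetherianSpace.isCompact (CofiniteTopology.of '' S)).image
    continuous_some_cofiniteJoinTop
  simpa [image_image] using h

theorem not_isDStarSpace_upperVietoris_cofiniteJoinTop :
    ¬ @IsDStarSpace (@SmythPow (Option ℕ) cofiniteJoinTop)
        (@upperVietoris (Option ℕ) cofiniteJoinTop) := by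
  let := cofiniteJoinTop
  let := upperVietoris (Option ℕ)
  have := t1Space_cofiniteJoinTop
  have saturated {K : Set (Option ℕ)} ⦃x y : Option ℕ⦄ (h : specLE x y) (hx : x ∈ K) : y ∈ K :=
    specLE_iff_eq.1 h ▸ hx
  let tail (n : ℕ) : SmythPow (Option ℕ) :=
    ⟨some '' Ici n, nonempty_Ici.image _, isCompact_image_some_cofiniteJoinTop _, saturated⟩
  have tail_anti {m n : ℕ} (h : m ≤ n) : (tail n).1 ⊆ (tail m).1 :=
    image_mono (Ici_subset_Ici.2 h)
  have directed : DirectedOn specLE (range tail) := by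
    rintro _ ⟨m, rfl⟩ _ ⟨n, rfl⟩
    exact ⟨_, mem_range_self (max m n), specLE_upperVietoris_iff.2 (tail_anti (le_max_left m n)),
      specLE_upperVietoris_iff.2 (tail_anti (le_max_right m n))⟩
  have isOpen_box : IsOpen {K : SmythPow (Option ℕ) | K.1 ⊆ {none}} :=
    TopologicalSpace.isOpen_generateFrom_of_mem
      ⟨{none}, TopologicalSpace.isOpen_generateFrom_of_mem (Or.inr rfl), rfl⟩
  have subset_box : (⋂ d ∈ range tail, upSet d) ∩ upSet (tail 0) ⊆ {K | K.1 ⊆ {none}} := by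
    rintro K ⟨hK, -⟩
    exfalso
    have hsub (n : ℕ) : K.1 ⊆ (tail n).1 :=
      specLE_upperVietoris_iff.1 (mem_iInter₂.1 hK _ (mem_range_self n))
    obtain ⟨x, hx⟩ := K.2.1
    obtain ⟨m, -, rfl⟩ := hsub 0 hx
    obtain ⟨k, hk, hkm⟩ := hsub (m + 1) hx
    obtain rfl := Option.some_injective _ hkm
    exact Nat.not_succ_le_self k hk
  intro h
  obtain ⟨_, ⟨n, rfl⟩, hn⟩ := h (range tail) (range_nonempty tail) directed (tail 0) _ isOpen_box
    ⟨⟨{none}, singleton_nonempty _, isCompact_singleton, saturated⟩, Subset.rfl⟩ subset_box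
  have hmem : tail n ∈ upSet (tail n) ∩ upSet (tail 0) :=
    ⟨specLE_upperVietoris_iff.2 Subset.rfl, specLE_upperVietoris_iff.2 (tail_anti n.zero_le)⟩
  exact Option.some_ne_none n (hn hmem ⟨n, self_mem_Ici, rfl⟩)

/-- `X = ℕ ∪ {a}` with the join of the cofinite topology on `ℕ` and the discrete topology
on `{a}` is a `T₁` space, hence a d*-space, but its Smyth power space `Q_v(X)` is not a
d*-space. -/
theorem cofiniteJoin_t1_dstar_smyth_not_dstar :
    @T1Space (Option ℕ) cofiniteJoinTop ∧
    @IsDStarSpace (Option ℕ) cofiniteJoinTop ∧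
    ¬ @IsDStarSpace (@SmythPow (Option ℕ) cofiniteJoinTop)
        (@upperVietoris (Option ℕ) cofiniteJoinTop) := by
  have := t1Space_cofiniteJoinTop
  exact ⟨t1Space_cofiniteJoinTop, @isDStarSpace_of_t1Space _ cofiniteJoinTop this,
    not_isDStarSpace_upperVietoris_cofiniteJoinTop⟩
end
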